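/- Let μ be a distribution on Q_d that is monotone increasing, i.e. μ(X) ≤ μ(Y) whenever X ⊆ Y (meaning x_i ≤ y_i for all i). Then (𝟏,𝟏) is an equilibrium for the two-player Voronoi game on Q_d with distribution μ. -/

import Mathlib

open Finset

/-- Hamming distance on the hypercube `{0,1}^d` (modelled as `Fin d → Bool`). -/
def hamming {d : ℕ} (X Y : Fin d → Bool) : ℕ :=
  (Finset.univ.filter (fun i => X i ≠ Y i)).card

/-- Number of 1-coordinates of a point of the hypercube. -/
def nOnes {d : ℕ} (X : Fin d → Bool) : ℕ :=
  (Finset.univ.filter (fun i => X i = true)).card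

/-- `μ` is a probability distribution on the hypercube. -/
def IsDistribution {d : ℕ} (μ : (Fin d → Bool) → ℝ) : Prop :=
  (∀ X, 0 ≤ μ X) ∧ ∑ X : Fin d → Bool, μ X = 1

open Classical in
/-- The weight of a set of points under `μ`. -/
noncomputable def wt {d : ℕ} (μ : (Fin d → Bool) → ℝ) (S : Set (Fin d → Bool)) : ℝ :=
  ∑ X : Fin d → Bool, if X ∈ S then μ X else 0

/-- Payoff to player 1, positioned at `A`, against player 2 positioned at `B`. -/
noncomputable def P1 {d : ℕ} (μ : (Fin d → Bool) → ℝ) (A B : Fin d → Bool) : ℝ :=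
  wt μ {X | hamming X A < hamming X B} + (1/2) * wt μ {X | hamming X A = hamming X B}

/-- Payoff to player 2, positioned at `B`, against player 1 positioned at `A`. -/
noncomputable def P2 {d : ℕ} (μ : (Fin d → Bool) → ℝ) (A B : Fin d → Bool) : ℝ :=
  wt μ {X | hamming X B < hamming X A} + (1/2) * wt μ {X | hamming X A = hamming X B}

/-- `(A,B)` is an equilibrium: neither player can strictly improve by moving. -/
def IsEquilibrium {d : ℕ} (μ : (Fin d → Bool) → ℝ) (A B : Fin d → Bool) : Prop :=
  (∀ A', P1 μ A' B ≤ P1 μ A B) ∧ (∀ B', P2 μ A B' ≤ P2 μ A B)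

/-- `w_i^0`: the weight of the subcube where coordinate `i` equals 0. -/
noncomputable def w0 {d : ℕ} (μ : (Fin d → Bool) → ℝ) (i : Fin d) : ℝ :=
  wt μ {X | X i = false}

/-- The all-zeros point `𝟎`. -/
def zeroPt (d : ℕ) : Fin d → Bool := fun _ => false

/-- The all-ones point `𝟏`. -/
def onePt (d : ℕ) : Fin d → Bool := fun _ => true

/-- The share of the voter `X` won by a player at `A` against a player at `B`. -/
noncomputable def voterShare {d : ℕ} (A B X : Fin d → Bool) : ℝ :=
  if hamming X A < hamming X B then 1 else if hamming X A = hamming X B then 1 / 2 else 0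

lemma voterShare_le_one {d : ℕ} (A B X : Fin d → Bool) : voterShare A B X ≤ 1 := by
  unfold voterShare
  split_ifs <;> norm_num

lemma P1_eq_sum_voterShare {d : ℕ} (μ : (Fin d → Bool) → ℝ) (A B : Fin d → Bool) :
    P1 μ A B = ∑ X, μ X * voterShare A B X := by
  unfold P1 wt
  rw [Finset.mul_sum, ← Finset.sum_add_distrib]
  refine Finset.sum_congr rfl fun X _ => ?_
  simp only [voterShare, Set.mem_ofPred_eq]
  split_ifs <;> first | omega | ring

lemma P2_eq_P1_swap {d : ℕ} (μ : (Fin d → Bool) → ℝ) (A B : Fin d → Bool) :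
    P2 μ A B = P1 μ B A := by
  simp only [P1, P2, eq_comm]

lemma P1_self {d : ℕ} {μ : (Fin d → Bool) → ℝ} (hμ : IsDistribution μ) (A : Fin d → Bool) :
    P1 μ A A = 1 / 2 := by
  simp [P1, wt, hμ.2]

lemma hamming_compl_add {d : ℕ} (X A : Fin d → Bool) : hamming Xᶜ A + hamming X A = d := by
  simp only [hamming, Finset.card_filter]
  rw [← Finset.sum_add_distrib]
  trans ∑ _i : Fin d, 1
  · refine Finset.sum_congr rfl fun i _ => ?_
    rw [Pi.compl_apply]
    cases X i <;> cases A i <;> rfl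
  · simp

lemma voterShare_compl_add {d : ℕ} (A B X : Fin d → Bool) :
    voterShare A B Xᶜ + voterShare A B X = 1 := by
  have hA := hamming_compl_add X A
  have hB := hamming_compl_add X B
  unfold voterShare
  split_ifs <;> first | omega | norm_num

lemma two_mul_sum_voterShare {d : ℕ} (A B : Fin d → Bool) :
    2 * ∑ X, voterShare A B X = ∑ _X : Fin d → Bool, (1 : ℝ) := by
  have h : ∑ X, voterShare A B Xᶜ = ∑ X, voterShare A B X :=
    Equiv.sum_comp (compl_involutive (α := Fin d → Bool)).toPerm (voterShare A B)
  rw [two_mul]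
  nth_rw 1 [← h]
  rw [← Finset.sum_add_distrib]
  exact Finset.sum_congr rfl fun X _ => voterShare_compl_add A B X

lemma hamming_add_hamming_onePt_le {d : ℕ} (A : Fin d → Bool) {X Y : Fin d → Bool}
    (hXY : X ≤ Y) :
    hamming X A + hamming Y (onePt d) ≤ hamming Y A + hamming X (onePt d) := by
  simp only [hamming, Finset.card_filter, ← Finset.sum_add_distrib]
  refine Finset.sum_le_sum fun i _ => ?_
  have hi := hXY i
  revert hi
  simp only [onePt]
  cases X i <;> cases Y i <;> cases A i <;> simp

lemma antitone_voterShare_onePt {d : ℕ} (A : Fin d → Bool) :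
    Antitone (voterShare A (onePt d)) := by
  intro X Y hXY
  have h := hamming_add_hamming_onePt_le A hXY
  unfold voterShare
  split_ifs <;> first | omega | norm_num

lemma P1_onePt_le_half {d : ℕ} {μ : (Fin d → Bool) → ℝ} (hμ : IsDistribution μ)
    (hmono : Monotone μ) (A : Fin d → Bool) : P1 μ A (onePt d) ≤ 1 / 2 := by
  have h := fkg (f := μ) (g := fun X => 1 - voterShare A (onePt d) X)
    (μ := fun _ : Fin d → Bool => (1 : ℝ)) (fun _ => zero_le_one) hμ.1
    (fun X => sub_nonneg.2 (voterShare_le_one _ _ X)) hmono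
    (fun _ _ hXY => sub_le_sub_left (antitone_voterShare_onePt A hXY) 1) (fun _ _ => le_rfl)
  have hsum := two_mul_sum_voterShare A (onePt d)
  have hpos : 0 < ∑ _X : Fin d → Bool, (1 : ℝ) :=
    Finset.sum_pos (fun _ _ => one_pos) Finset.univ_nonempty
  simp only [one_mul, mul_sub, mul_one, Finset.sum_sub_distrib, hμ.2] at h
  rw [← P1_eq_sum_voterShare] at h
  nlinarith

theorem statement_14 (d : ℕ) (μ : (Fin d → Bool) → ℝ) (hμ : IsDistribution μ)
    (hmono : ∀ X Y : Fin d → Bool, (∀ i, X i ≤ Y i) → μ X ≤ μ Y) :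
    IsEquilibrium μ (onePt d) (onePt d) := by
  refine ⟨fun A => ?_, fun B => ?_⟩
  · rw [P1_self hμ]
    exact P1_onePt_le_half hμ hmono A
  · rw [P2_eq_P1_swap, P2_eq_P1_swap, P1_self hμ]
    exact P1_onePt_le_half hμ hmono B
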